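/- Let T be a tempered measure on ℝ^d whose distributional Fourier transform T̂ is translation bounded as a distribution. If T is a pure-point measure, then T̂ is strongly almost periodic as a distribution. -/

import Mathlib

set_option linter.unusedSectionVars false

open MeasureTheory Filter Metric Complex SchwartzMap
open scoped Topology ENNReal NNReal ComplexConjugate

noncomputable section

section Preamble

variable {E : Type*} [NormedAddCommGroup E] [InnerProductSpace ℝ E] [FiniteDimensional ℝ E]
  [MeasurableSpace E] [BorelSpace E]

/-- A set is relatively dense if it has bounded gaps. -/
def IsRelativelyDense (A : Set E) : Prop :=
  ∃ r : ℝ, ∀ x : E, ∃ a ∈ A, dist x a ≤ r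

/-- Bohr almost periodic functions: uniformly continuous, bounded, with relatively
dense sets of ε-almost periods. -/
def IsBohrAP (f : E → ℂ) : Prop :=
  UniformContinuous f ∧ (∃ C : ℝ, ∀ x, ‖f x‖ ≤ C) ∧
    ∀ ε : ℝ, 0 < ε → IsRelativelyDense {t : E | ∀ x, ‖f (x - t) - f x‖ < ε}

/-- Bounded functions. -/
def IsBddFun (f : E → ℂ) : Prop := ∃ C : ℝ, ∀ x, ‖f x‖ ≤ C

lemma isometry_const_sub (x : E) : Isometry (fun y : E => x - y) :=
  Isometry.of_dist_eq (fun a b => dist_sub_left x a b)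

lemma hasTemperateGrowth_const_sub (x : E) :
    Function.HasTemperateGrowth (fun y : E => x - y) := by
  apply Function.HasTemperateGrowth.of_fderiv (k := 1) (C := ‖x‖ + 1)
  · have h : (fderiv ℝ (fun y : E => x - y)) =
        fun _ : E => ((0 : E →L[ℝ] E) - ContinuousLinearMap.id ℝ E) := by
      funext y
      exact ((hasFDerivAt_const x y).sub (hasFDerivAt_id y)).fderiv
    rw [h]
    exact Function.HasTemperateGrowth.const _
  · exact (differentiable_const x).sub differentiable_id
  · intro y
    have h1 : ‖x - y‖ ≤ ‖x‖ + ‖y‖ := norm_sub_le x y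
    have h2 : (0:ℝ) ≤ ‖x‖ := norm_nonneg x
    have h3 : (0:ℝ) ≤ ‖y‖ := norm_nonneg y
    calc ‖x - y‖ ≤ ‖x‖ + ‖y‖ := h1
      _ ≤ (‖x‖ + 1) * (1 + ‖y‖) ^ 1 := by nlinarith

/-- The reflected translate `y ↦ ψ (x - y)` of a Schwartz function. -/
def transRefl (x : E) (ψ : SchwartzMap E ℂ) : SchwartzMap E ℂ :=
  SchwartzMap.compCLMOfAntilipschitz (K := 1) ℝ (hasTemperateGrowth_const_sub x)
    (isometry_const_sub x).antilipschitz ψ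

@[simp] lemma transRefl_apply (x : E) (ψ : SchwartzMap E ℂ) (y : E) :
    transRefl x ψ y = ψ (x - y) := rfl

/-- Convolution of a tempered distribution with a Schwartz function:
`(T * ψ)(x) = T (ψ (x - ·))`. -/
def convTD (T : SchwartzMap E ℂ →L[ℂ] ℂ) (ψ : SchwartzMap E ℂ) : E → ℂ :=
  fun x => T (transRefl x ψ)

/-- Smooth compactly supported test function, regarded inside the Schwartz space. -/
def IsTestFn (φ : SchwartzMap E ℂ) : Prop := HasCompactSupport ⇑φ

/-- Translation bounded as a tempered distribution. -/
def TransBddTD (T : SchwartzMap E ℂ →L[ℂ] ℂ) : Prop :=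
  ∀ ψ : SchwartzMap E ℂ, IsBddFun (convTD T ψ)

/-- Translation bounded as a distribution. -/
def TransBddD (T : SchwartzMap E ℂ →L[ℂ] ℂ) : Prop :=
  ∀ ψ : SchwartzMap E ℂ, IsTestFn ψ → IsBddFun (convTD T ψ)

/-- Strongly almost periodic as a tempered distribution. -/
def SAPTD (T : SchwartzMap E ℂ →L[ℂ] ℂ) : Prop :=
  ∀ ψ : SchwartzMap E ℂ, IsBohrAP (convTD T ψ)

/-- Strongly almost periodic as a distribution. -/
def SAPD (T : SchwartzMap E ℂ →L[ℂ] ℂ) : Prop :=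
  ∀ ψ : SchwartzMap E ℂ, IsTestFn ψ → IsBohrAP (convTD T ψ)

/-- The distributional Fourier transform, `T̂(φ) = T(φ̂)`, with the convention
`φ̂(ξ) = ∫ e^{-2πi⟨x,ξ⟩} φ(x) dx`. -/
def fourierTD (T : SchwartzMap E ℂ →L[ℂ] ℂ) : SchwartzMap E ℂ →L[ℂ] ℂ :=
  T.comp (SchwartzMap.fourierTransformCLM ℂ)

/-- A complex Radon measure, encoded by its total variation measure together with a
unimodular density (polar decomposition). -/
structure CMeasure (E : Type*) [TopologicalSpace E] [MeasurableSpace E] where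
  /-- the total variation measure -/
  tv : Measure E
  locFin : IsLocallyFiniteMeasure tv
  /-- the unimodular density -/
  density : E → ℂ
  density_meas : Measurable density
  density_norm : ∀ᵐ x ∂tv, ‖density x‖ = 1

namespace CMeasure

/-- Pairing of a complex measure with a function: `μ(φ) = ∫ φ dμ`. -/
def pairing (μ : CMeasure E) (φ : E → ℂ) : ℂ := ∫ x, φ x * μ.density x ∂μ.tv

/-- The complex measure agrees with the tempered distribution `T` on all smooth
compactly supported test functions; i.e. `μ` is a tempered measure identified with `T`. -/
def Agrees (μ : CMeasure E) (T : SchwartzMap E ℂ →L[ℂ] ℂ) : Prop :=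
  ∀ φ : SchwartzMap E ℂ, IsTestFn φ → T φ = μ.pairing ⇑φ

/-- A tempered measure is one that extends to a tempered distribution. -/
def IsTempered (μ : CMeasure E) : Prop := ∃ T, μ.Agrees T

/-- Pure point measure: concentrated on a countable set. -/
def IsPurePoint (μ : CMeasure E) : Prop := ∃ S : Set E, S.Countable ∧ μ.tv Sᶜ = 0

/-- Convolution of a complex measure with a function: `(μ * φ)(x) = ∫ φ(x - y) dμ(y)`. -/
def convM (μ : CMeasure E) (φ : E → ℂ) : E → ℂ :=
  fun x => ∫ y, φ (x - y) * μ.density y ∂μ.tv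

/-- Translation bounded as a measure. -/
def TransBddM (μ : CMeasure E) : Prop :=
  ∀ φ : E → ℂ, Continuous φ → HasCompactSupport φ → IsBddFun (μ.convM φ)

/-- Strongly almost periodic as a measure. -/
def SAPM (μ : CMeasure E) : Prop :=
  ∀ φ : E → ℂ, Continuous φ → HasCompactSupport φ → IsBohrAP (μ.convM φ)

/-- Strongly tempered measure: the total variation has polynomial growth,
equivalently `|μ|` is a tempered (slowly increasing) measure. -/
def IsStronglyTempered (μ : CMeasure E) : Prop :=
  ∃ C a : ℝ, ∀ r : ℝ, 1 ≤ r → μ.tv (Metric.closedBall 0 r) ≤ ENNReal.ofReal (C * r ^ a)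

/-- The atom of a complex measure at a point: `μ({x})`. -/
def atom (μ : CMeasure E) (x : E) : ℂ := (μ.tv {x}).toReal • μ.density x

/-- The measure is concentrated on a locally finite set. -/
def LocallyFiniteSupport (μ : CMeasure E) : Prop :=
  ∃ S : Set E, (∀ K : Set E, IsCompact K → (S ∩ K).Finite) ∧ μ.tv Sᶜ = 0

end CMeasure

end Preamble


section Helpers

open scoped FourierTransform ContDiff LineDeriv

variable {E : Type*} [NormedAddCommGroup E] [InnerProductSpace ℝ E] [FiniteDimensional ℝ E]
  [MeasurableSpace E] [BorelSpace E]

/-- A fixed bump function. -/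
def bmp (E : Type*) [NormedAddCommGroup E] [InnerProductSpace ℝ E] [FiniteDimensional ℝ E] :
    ContDiffBump (0 : E) := ⟨1, 2, one_pos, one_lt_two⟩

def bmpC (z : E) : ℂ := ((bmp E z : ℝ) : ℂ)

lemma bmpC_contDiff : ContDiff ℝ ∞ (bmpC (E := E)) :=
  Complex.ofRealCLM.contDiff.comp (bmp E).contDiff

lemma bmpC_compact : HasCompactSupport (bmpC (E := E)) :=
  (bmp E).hasCompactSupport.comp_left (g := Complex.ofReal) Complex.ofReal_zero

lemma bmpC_eq_one {z : E} (hz : ‖z‖ ≤ 1) : bmpC z = 1 := by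
  have : bmp E z = 1 := (bmp E).one_of_mem_closedBall (by simpa [bmp] using hz)
  simp [bmpC, this]

/-- scale -/
def scl (n : ℕ) : ℝ := ((n : ℝ) + 1)⁻¹

lemma scl_pos (n : ℕ) : 0 < scl n := by unfold scl; positivity

lemma scl_le (n : ℕ) : scl n ≤ 1 := by
  unfold scl
  apply inv_le_one_of_one_le₀
  have : (0 : ℝ) ≤ n := by positivity
  linarith

lemma scl_tendsto : Tendsto scl atTop (𝓝 0) := by
  have := tendsto_one_div_add_atTop_nhds_zero_nat (𝕜 := ℝ)
  simp only [one_div] at this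
  exact this

def cutf (n : ℕ) (z : E) : ℂ := bmpC (scl n • z)

lemma cutf_contDiff (n : ℕ) : ContDiff ℝ ∞ (cutf (E := E) n) :=
  bmpC_contDiff.comp (contDiff_const_smul (scl n))

lemma cutf_compact (n : ℕ) : HasCompactSupport (cutf (E := E) n) :=
  bmpC_compact.comp_homeomorph (Homeomorph.smulOfNeZero (scl n) (scl_pos n).ne')

lemma cutf_temp (n : ℕ) : (cutf (E := E) n).HasTemperateGrowth :=
  (cutf_compact n).hasTemperateGrowth (cutf_contDiff n)

def cutM (n : ℕ) : SchwartzMap E ℂ →L[ℂ] SchwartzMap E ℂ := smulLeftCLM ℂ (cutf n)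

lemma cutM_apply (n : ℕ) (g : SchwartzMap E ℂ) (z : E) : cutM n g z = cutf n z * g z := by
  simp [cutM, smulLeftCLM_apply_apply (cutf_temp n)]

lemma cutM_test (n : ℕ) (g : SchwartzMap E ℂ) : IsTestFn (cutM n g) := by
  have : (⇑(cutM n g)) = fun z => cutf n z * g z := funext (cutM_apply n g)
  rw [IsTestFn, this]
  exact (cutf_compact n).mul_right

lemma cutM_tendsto (g : SchwartzMap E ℂ) :
    Tendsto (fun n => cutM n g) atTop (𝓝 g) := by
  rw [(schwartz_withSeminorms ℝ E ℂ).tendsto_nhds]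
  rintro ⟨k, l⟩ ε hε
  let η : E → ℂ := fun z => bmpC z - 1
  have hηs : ContDiff ℝ ∞ η := bmpC_contDiff.sub contDiff_const
  have hη : η.HasTemperateGrowth :=
    (bmpC_compact.hasTemperateGrowth bmpC_contDiff).sub (Function.HasTemperateGrowth.const 1)
  obtain ⟨K, C, hC, hb⟩ := hη.norm_iteratedFDeriv_le_uniform l
  have hzero : ∀ i : ℕ, ∀ z : E, ‖z‖ < 1 → iteratedFDeriv ℝ i η z = 0 := by
    intro i z hz
    have : η =ᶠ[𝓝 z] (fun _ => (0:ℂ)) := by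
      filter_upwards [(isOpen_lt continuous_norm continuous_const).mem_nhds hz] with y hy
      simp [η, bmpC_eq_one (le_of_lt hy)]
    rw [(Filter.EventuallyEq.iteratedFDeriv ℝ this i).eq_of_nhds]
    exact congrFun (iteratedFDeriv_fun_zero (𝕜 := ℝ)) z
  set D : ℝ := ∑ i ∈ Finset.range (l + 1), (l.choose i : ℝ) * C *
    (2 ^ (k + K + 1) * (Finset.Iic (k + K + 1, l)).sup
      (fun m => SchwartzMap.seminorm ℝ m.1 m.2) g) with hD
  have hD0 : 0 ≤ D := by
    rw [hD]; exact Finset.sum_nonneg fun i _ => by positivity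
  have main : ∀ n : ℕ, SchwartzMap.seminorm ℝ k l (cutM n g - g) ≤ scl n * D := by
    intro n
    apply SchwartzMap.seminorm_le_bound _ _ _ _ (mul_nonneg (scl_pos n).le hD0)
    intro x
    have e1 : (⇑(cutM n g - g)) = fun z => η (scl n • z) * g z := by
      funext z
      simp [cutM_apply, η, cutf, sub_mul]
    rw [e1]
    have h1 := norm_iteratedFDeriv_mul_le (𝕜 := ℝ) (N := ∞) (n := l)
      (hηs.comp (contDiff_const_smul (scl n))) (g.smooth ⊤) x (mod_cast le_top)
    refine (mul_le_mul_of_nonneg_left h1 (by positivity)).trans ?_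
    rw [hD, Finset.mul_sum, Finset.mul_sum]
    refine Finset.sum_le_sum fun i hi => ?_
    have hi' : i ≤ l := by simpa [Nat.lt_succ_iff] using hi
    have h2 : iteratedFDeriv ℝ i (η ∘ fun z : E => scl n • z) x
        = scl n ^ i • iteratedFDeriv ℝ i η (scl n • x) := by
      have := iteratedFDeriv_comp_const_smul (𝕜 := ℝ) (i := i) (f := η) (scl n)
        (hηs.of_le (mod_cast le_top))
      exact congrFun this x
    have hx0 := norm_nonneg x
    have hs := scl_pos n
    have hs1 := scl_le n
    have h3 : ‖iteratedFDeriv ℝ i (η ∘ fun z : E => scl n • z) x‖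
        ≤ C * (1 + ‖x‖) ^ K * (scl n * (1 + ‖x‖)) := by
      rw [h2, norm_smul, norm_pow, Real.norm_of_nonneg hs.le]
      by_cases hz : ‖scl n • x‖ < 1
      · rw [hzero i _ hz]; simp; positivity
      · have hz' : 1 ≤ scl n * (1 + ‖x‖) := by
          rw [norm_smul, Real.norm_of_nonneg hs.le] at hz
          nlinarith
        have a1 : scl n ^ i ≤ 1 := pow_le_one₀ hs.le hs1
        have a2 : ‖iteratedFDeriv ℝ i η (scl n • x)‖ ≤ C * (1 + ‖x‖) ^ K := by
          refine (hb i hi' _).trans ?_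
          have : ‖scl n • x‖ ≤ ‖x‖ := by
            rw [norm_smul, Real.norm_of_nonneg hs.le]; nlinarith
          gcongr
        calc _ ≤ 1 * (C * (1 + ‖x‖) ^ K) := by gcongr
          _ = C * (1 + ‖x‖) ^ K * 1 := by ring
          _ ≤ _ := by gcongr
    have h4 := one_add_le_sup_seminorm_apply (𝕜 := ℝ) (m := (k + K + 1, l)) (k := k + K + 1)
      (n := l - i) le_rfl (Nat.sub_le _ _) g x
    have h5 : ‖x‖ ^ k ≤ (1 + ‖x‖) ^ k := by gcongr; linarith
    calc ‖x‖ ^ k * ((l.choose i : ℝ) * ‖iteratedFDeriv ℝ i (η ∘ fun z : E => scl n • z) x‖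
            * ‖iteratedFDeriv ℝ (l - i) g x‖)
        ≤ (1 + ‖x‖) ^ k * ((l.choose i : ℝ) * (C * (1 + ‖x‖) ^ K * (scl n * (1 + ‖x‖)))
            * ‖iteratedFDeriv ℝ (l - i) g x‖) := by gcongr
      _ = scl n * ((l.choose i : ℝ) * C * ((1 + ‖x‖) ^ (k + K + 1) *
            ‖iteratedFDeriv ℝ (l - i) g x‖)) := by ring
      _ ≤ _ := by gcongr
  have hlim : Tendsto (fun n : ℕ => scl n * D) atTop (𝓝 0) := by
    have := scl_tendsto
    simpa using this.mul_const D
  filter_upwards [hlim.eventually_lt_const hε] with n hn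
  exact (main n).trans_lt hn

/-- Complex-linear version of `transRefl`. -/
def trC (x : E) : SchwartzMap E ℂ →L[ℂ] SchwartzMap E ℂ :=
  SchwartzMap.compCLMOfAntilipschitz (K := 1) ℂ (hasTemperateGrowth_const_sub x)
    (isometry_const_sub x).antilipschitz

lemma trC_eq (x : E) (ψ : SchwartzMap E ℂ) : transRefl x ψ = trC x ψ := rfl

@[simp] lemma trC_apply (x : E) (ψ : SchwartzMap E ℂ) (y : E) : trC x ψ y = ψ (x - y) := rfl

lemma norm_iter_trC (x : E) (ψ : SchwartzMap E ℂ) (l : ℕ) (y : E) :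
    ‖iteratedFDeriv ℝ l (trC x ψ) y‖ = ‖iteratedFDeriv ℝ l ψ (x - y)‖ := by
  have e : (⇑(trC x ψ)) = (fun z => ψ (x + z)) ∘ (LinearIsometryEquiv.neg ℝ (E := E)) := by
    funext z; simp [sub_eq_add_neg]
  rw [e, LinearIsometryEquiv.norm_iteratedFDeriv_comp_right, iteratedFDeriv_comp_add_left]
  simp [sub_eq_add_neg]

lemma poly_bound (S : SchwartzMap E ℂ →L[ℂ] ℂ) :
    ∃ (N : ℕ) (q : SchwartzMap E ℂ → ℝ), Continuous q ∧
      ∀ x ψ, ‖S (trC x ψ)‖ ≤ (1 + ‖x‖) ^ N * q ψ := by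
  let q0 : Seminorm ℝ (SchwartzMap E ℂ) :=
    (normSeminorm ℝ ℂ).comp (S.restrictScalars ℝ).toLinearMap
  have hq0 : Continuous q0 := continuous_norm.comp S.continuous
  obtain ⟨s, C, -, hC⟩ := Seminorm.bound_of_continuous (schwartz_withSeminorms ℝ E ℂ) q0 hq0
  let N := s.sup Prod.fst
  let L := s.sup Prod.snd
  let Q : Seminorm ℝ (SchwartzMap E ℂ) := (Finset.Iic (N, L)).sup (schwartzSeminormFamily ℝ E ℂ)
  have hQ : Continuous Q := by
    apply Seminorm.continuous_finsetSup
    intro i _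
    exact (schwartz_withSeminorms ℝ E ℂ).continuous_seminorm i
  refine ⟨N, fun ψ => C * (2 ^ N * Q ψ), by fun_prop, fun x ψ => ?_⟩
  have hQ0 : 0 ≤ Q ψ := apply_nonneg _ _
  have h1 : ‖S (trC x ψ)‖ ≤ C * (s.sup (schwartzSeminormFamily ℝ E ℂ)) (trC x ψ) := hC (trC x ψ)
  have h2 : (s.sup (schwartzSeminormFamily ℝ E ℂ)) (trC x ψ) ≤ (1 + ‖x‖) ^ N * (2 ^ N * Q ψ) := by
    apply Seminorm.finset_sup_apply_le (by positivity)
    rintro ⟨k, l⟩ hkl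
    have hk : k ≤ N := Finset.le_sup (f := Prod.fst) hkl
    have hl : l ≤ L := Finset.le_sup (f := Prod.snd) hkl
    apply SchwartzMap.seminorm_le_bound _ _ _ _ (by positivity)
    intro y
    rw [norm_iter_trC]
    have h4 := one_add_le_sup_seminorm_apply (𝕜 := ℝ) (m := (N, L)) (k := N)
      (n := l) le_rfl hl ψ (x - y)
    have h5 : ‖y‖ ≤ (1 + ‖x‖) * (1 + ‖x - y‖) := by
      have : ‖y‖ ≤ ‖x‖ + ‖x - y‖ := by
        have := norm_sub_le x (x - y); simpa using this
      nlinarith [norm_nonneg x, norm_nonneg (x - y)]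
    have h6 : ‖y‖ ^ k ≤ ((1 + ‖x‖) * (1 + ‖x - y‖)) ^ N := by
      refine (pow_le_pow_left₀ (norm_nonneg _) h5 k).trans (pow_le_pow_right₀ ?_ hk)
      nlinarith [norm_nonneg x, norm_nonneg (x - y)]
    calc _ ≤ ((1 + ‖x‖) * (1 + ‖x - y‖)) ^ N * ‖iteratedFDeriv ℝ l ψ (x - y)‖ := by gcongr
      _ = (1 + ‖x‖) ^ N * ((1 + ‖x - y‖) ^ N * ‖iteratedFDeriv ℝ l ψ (x - y)‖) := by
        rw [mul_pow]; ring
      _ ≤ _ := mul_le_mul_of_nonneg_left h4 (by positivity)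
  calc _ ≤ C * ((1 + ‖x‖) ^ N * (2 ^ N * Q ψ)) := h1.trans (by gcongr)
    _ = _ := by ring

/-- The character. -/
def ee (x ξ : E) : ℂ := (Real.fourierChar (-(inner ℝ x ξ)) : ℂ)

@[simp] lemma norm_ee (x ξ : E) : ‖ee x ξ‖ = 1 := Circle.norm_coe _

lemma ee_add (x y ξ : E) : ee (x + y) ξ = ee x ξ * ee y ξ := by
  simp [ee, inner_add_left, add_comm, AddChar.map_add_eq_mul]

lemma ee_cont : Continuous (fun p : E × E => ee p.1 p.2) := by
  unfold ee
  have := Real.continuous_fourierChar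
  fun_prop

lemma ee_exp (x ξ : E) : ee x ξ = Complex.exp (-(2 * Real.pi * (inner ℝ x ξ : ℝ)) * I) := by
  rw [ee, Real.fourierChar_apply]; push_cast; ring_nf

/-- Multiplication by the character. -/
def mE (x : E) : SchwartzMap E ℂ →L[ℂ] SchwartzMap E ℂ :=
  (SchwartzMap.fourierTransformCLM ℂ) ∘L (trC x) ∘L (trC 0) ∘L
    (FourierTransform.fourierInvCLM ℂ (SchwartzMap E ℂ))

lemma fourier_trC (x : E) (u : SchwartzMap E ℂ) (ξ : E) :
    (SchwartzMap.fourierTransformCLM ℂ (trC x u)) ξ = ee x ξ * (𝓕 u) (-ξ) := by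
  simp only [SchwartzMap.fourierTransformCLM_apply, SchwartzMap.fourier_coe, Real.fourier_eq]
  have h := integral_sub_left_eq_self
    (fun v => Real.fourierChar (-(inner ℝ (x - v) ξ)) • u v) volume x
  simp only [sub_sub_cancel] at h
  simp only [trC_apply]
  rw [h, ← integral_const_mul]
  congr 1
  funext v
  simp only [Circle.smul_def, smul_eq_mul, ee, ← mul_assoc]
  congr 1
  rw [← Circle.coe_mul, ← AddChar.map_add_eq_mul]
  congr 2
  rw [inner_sub_left, inner_neg_right]; ring

lemma mE_apply (x : E) (g : SchwartzMap E ℂ) (ξ : E) : mE x g ξ = ee x ξ * g ξ := by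
  have : mE x g = SchwartzMap.fourierTransformCLM ℂ (trC x (trC 0 (𝓕⁻ g))) := rfl
  rw [this, fourier_trC]
  congr 1
  have := fourier_trC 0 (𝓕⁻ g) (-ξ)
  simp only [SchwartzMap.fourierTransformCLM_apply] at this
  rw [this, neg_neg, FourierTransform.fourier_fourierInv_eq]
  simp [ee]

lemma mE_test (x : E) {g : SchwartzMap E ℂ} (hg : IsTestFn g) : IsTestFn (mE x g) := by
  have : (⇑(mE x g)) = fun z => ee x z * g z := funext (mE_apply x g)
  rw [IsTestFn, this]
  exact HasCompactSupport.mul_left hg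

lemma mE_bound (T : SchwartzMap E ℂ →L[ℂ] ℂ) :
    ∃ (N : ℕ) (q : SchwartzMap E ℂ → ℝ), Continuous q ∧
      ∀ x g, ‖T (mE x g)‖ ≤ (1 + ‖x‖) ^ N * q g := by
  obtain ⟨N, q, hq, h⟩ := poly_bound (T ∘L SchwartzMap.fourierTransformCLM ℂ)
  refine ⟨N, fun g => q (trC 0 (𝓕⁻ g)), ?_, fun x g => h x _⟩
  exact hq.comp ((trC 0).continuous.comp
    (FourierTransform.fourierInvCLM ℂ (SchwartzMap E ℂ)).continuous)


lemma intg (μ : CMeasure E) {g : SchwartzMap E ℂ} (hg : IsTestFn g) :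
    Integrable (fun ξ => g ξ * μ.density ξ) μ.tv := by
  have := μ.locFin
  have h1 : Integrable (⇑g) μ.tv := g.continuous.integrable_of_hasCompactSupport hg
  exact h1.mul_bdd (c := 1) μ.density_meas.aestronglyMeasurable
    (μ.density_norm.mono fun x hx => hx.le)

lemma T_mE (μ : CMeasure E) (T : SchwartzMap E ℂ →L[ℂ] ℂ) (hμT : μ.Agrees T)
    {g : SchwartzMap E ℂ} (hg : IsTestFn g) (x : E) :
    T (mE x g) = ∫ ξ, ee x ξ * (g ξ * μ.density ξ) ∂μ.tv := by
  rw [hμT _ (mE_test x hg), CMeasure.pairing]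
  congr 1
  funext ξ
  rw [mE_apply, mul_assoc]

lemma T_mE_cont (μ : CMeasure E) (T : SchwartzMap E ℂ →L[ℂ] ℂ) (hμT : μ.Agrees T)
    {g : SchwartzMap E ℂ} (hg : IsTestFn g) : Continuous (fun x => T (mE x g)) := by
  simp_rw [T_mE μ T hμT hg]
  apply continuous_of_dominated (bound := fun ξ => ‖g ξ * μ.density ξ‖)
  · intro x
    have hc : Continuous (fun ξ => ee x ξ) := ee_cont.comp (by fun_prop : Continuous fun ξ => (x, ξ))
    exact hc.aestronglyMeasurable.mul (intg μ hg).aestronglyMeasurable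
  · intro x
    refine Eventually.of_forall fun ξ => ?_
    simp
  · exact (intg μ hg).norm
  · refine Eventually.of_forall fun ξ => ?_
    have hc : Continuous (fun x => ee x ξ) := ee_cont.comp (by fun_prop : Continuous fun x => (x, ξ))
    exact hc.mul continuous_const

lemma T_mE_meas (μ : CMeasure E) (T : SchwartzMap E ℂ →L[ℂ] ℂ) (hμT : μ.Agrees T)
    (g : SchwartzMap E ℂ) : StronglyMeasurable (fun x => T (mE x g)) := by
  refine stronglyMeasurable_of_tendsto atTop
    (fun n => (T_mE_cont μ T hμT (cutM_test n g)).stronglyMeasurable) ?_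
  rw [tendsto_pi_nhds]
  intro x
  exact ((T.continuous.comp (mE x).continuous).tendsto g).comp (cutM_tendsto g)

lemma key_test {Ω : Type*} [MeasurableSpace Ω] (ρ : Measure Ω) [SFinite ρ] (w : Ω → ℂ) (y : Ω → E)
    (hw : Integrable w ρ) (hy : Measurable y)
    (μ : CMeasure E) (T : SchwartzMap E ℂ →L[ℂ] ℂ) (hμT : μ.Agrees T)
    {h k : SchwartzMap E ℂ} (hh : IsTestFn h) (hk : IsTestFn k)
    (H : ∀ ξ, (∫ o, w o * ee (y o) ξ ∂ρ) * h ξ = k ξ) :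
    ∫ o, w o * T (mE (y o) h) ∂ρ = T k := by
  have := μ.locFin
  simp_rw [T_mE μ T hμT hh, ← integral_const_mul]
  rw [integral_integral_swap, hμT k hk, CMeasure.pairing]
  · congr 1
    funext ξ
    rw [← H, mul_assoc, ← integral_mul_const]
    congr 1
    funext o
    ring
  · have h1 := hw.mul_prod (intg μ hh)
    have hm : Measurable (fun p : Ω × E => ee (y p.1) p.2) :=
      ee_cont.measurable.comp ((hy.comp measurable_fst).prodMk measurable_snd)
    have h2 := h1.bdd_mul (c := 1) hm.aestronglyMeasurable
      (Eventually.of_forall fun p => (norm_ee _ _).le)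
    refine h2.congr (Eventually.of_forall fun p => ?_)
    simp only [Function.uncurry]
    ring

lemma key {Ω : Type*} [MeasurableSpace Ω] (ρ : Measure Ω) [SFinite ρ] (w : Ω → ℂ) (y : Ω → E)
    (hw : Integrable w ρ) (hy : Measurable y)
    (hint : ∀ N : ℕ, Integrable (fun o => (1 + ‖y o‖) ^ N * ‖w o‖) ρ)
    (μ : CMeasure E) (T : SchwartzMap E ℂ →L[ℂ] ℂ) (hμT : μ.Agrees T)
    (A B : SchwartzMap E ℂ →L[ℂ] SchwartzMap E ℂ)
    (hA : ∀ g, IsTestFn g → IsTestFn (A g)) (hB : ∀ g, IsTestFn g → IsTestFn (B g))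
    (H : ∀ g ξ, (∫ o, w o * ee (y o) ξ ∂ρ) * A g ξ = B g ξ) (g : SchwartzMap E ℂ) :
    ∫ o, w o * T (mE (y o) (A g)) ∂ρ = T (B g) := by
  obtain ⟨N, q, hq, hb⟩ := mE_bound T
  have hlim1 : Tendsto (fun n => T (B (cutM n g))) atTop (𝓝 (T (B g))) :=
    ((T.continuous.comp B.continuous).tendsto g).comp (cutM_tendsto g)
  have hqlim : Tendsto (fun n => q (A (cutM n g))) atTop (𝓝 (q (A g))) :=
    ((hq.comp A.continuous).tendsto g).comp (cutM_tendsto g)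
  obtain ⟨Q, hQ⟩ := hqlim.bddAbove_range
  have hlim2 : Tendsto (fun n => ∫ o, w o * T (mE (y o) (A (cutM n g))) ∂ρ) atTop
      (𝓝 (∫ o, w o * T (mE (y o) (A g)) ∂ρ)) := by
    apply tendsto_integral_of_dominated_convergence
      (fun o => (1 + ‖y o‖) ^ N * ‖w o‖ * Q)
    · intro n
      exact hw.aestronglyMeasurable.mul
        ((T_mE_meas μ T hμT _).comp_measurable hy).aestronglyMeasurable
    · exact (hint N).mul_const Q
    · intro n
      refine Eventually.of_forall fun o => ?_
      rw [norm_mul]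
      have h1 := hb (y o) (A (cutM n g))
      have h2 : q (A (cutM n g)) ≤ Q := hQ ⟨n, rfl⟩
      calc _ ≤ ‖w o‖ * ((1 + ‖y o‖) ^ N * Q) := by
            gcongr
            exact h1.trans (by gcongr)
        _ = _ := by ring
    · refine Eventually.of_forall fun o => ?_
      refine Tendsto.const_mul _ ?_
      exact ((T.continuous.comp ((mE (y o)).continuous.comp A.continuous)).tendsto g).comp
        (cutM_tendsto g)
  refine tendsto_nhds_unique hlim2 (hlim1.congr fun n => ?_)
  rw [key_test ρ w y hw hy μ T hμT (hA _ (cutM_test n g)) (hB _ (cutM_test n g)) (H _)]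


/-- Frequency-side avatar of a test function. -/
def gph (φ : SchwartzMap E ℂ) : SchwartzMap E ℂ := SchwartzMap.fourierTransformCLM ℂ (trC 0 φ)

lemma trC_trC (φ : SchwartzMap E ℂ) : trC 0 (trC 0 φ) = φ := by
  ext z; simp

lemma conv_eq (T : SchwartzMap E ℂ →L[ℂ] ℂ) (φ : SchwartzMap E ℂ) (x : E) :
    convTD (fourierTD T) φ x = T (mE x (gph φ)) := by
  have : mE x (gph φ) = SchwartzMap.fourierTransformCLM ℂ (trC x (trC 0 (𝓕⁻ (𝓕 (trC 0 φ))))) := rfl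
  rw [this, FourierTransform.fourierInv_fourier_eq, trC_trC]
  rfl

/-- Multiplication by the symbol of a directional derivative. -/
def Av (v : E) : SchwartzMap E ℂ →L[ℂ] SchwartzMap E ℂ :=
  (SchwartzMap.fourierTransformCLM ℂ) ∘L (trC 0) ∘L
    (LineDeriv.lineDerivOpCLM ℂ (SchwartzMap E ℂ) v) ∘L (trC 0) ∘L
    (FourierTransform.fourierInvCLM ℂ (SchwartzMap E ℂ))

lemma Av_gph (v : E) (φ : SchwartzMap E ℂ) : Av v (gph φ) = gph (∂_{v} φ) := by
  have : Av v (gph φ) = SchwartzMap.fourierTransformCLM ℂ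
    (trC 0 (∂_{v} (trC 0 (𝓕⁻ (𝓕 (trC 0 φ)))))) := rfl
  rw [this, FourierTransform.fourierInv_fourier_eq, trC_trC]
  rfl

lemma Av_apply (v : E) (g : SchwartzMap E ℂ) (ξ : E) :
    Av v g ξ = -(2 * Real.pi * (inner ℝ v ξ : ℝ)) * I * g ξ := by
  have : Av v g = SchwartzMap.fourierTransformCLM ℂ (trC 0 (∂_{v} (trC 0 (𝓕⁻ g)))) := rfl
  have h2 := fourier_trC 0 (𝓕⁻ g) (-ξ)
  simp only [SchwartzMap.fourierTransformCLM_apply, FourierTransform.fourier_fourierInv_eq, neg_neg] at h2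
  rw [this, fourier_trC, SchwartzMap.fourier_lineDerivOp_eq]
  have hT : (fun x : E => (inner ℝ x v : ℝ)).HasTemperateGrowth := by fun_prop
  rw [smul_apply, SchwartzMap.smulLeftCLM_apply_apply hT, h2]
  simp [ee, real_inner_comm]
  ring

lemma ld_test (v : E) {φ : SchwartzMap E ℂ} (hφ : IsTestFn φ) : IsTestFn (∂_{v} φ) := by
  exact hφ.mono' ((subset_tsupport _).trans (SchwartzMap.tsupport_lineDerivOp_subset v φ))

lemma Av_test (v : E) {g : SchwartzMap E ℂ} (hg : IsTestFn g) : IsTestFn (Av v g) := by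
  have : (⇑(Av v g)) = fun ξ => -(2 * Real.pi * (inner ℝ v ξ : ℝ)) * I * g ξ := funext (Av_apply v g)
  rw [IsTestFn, this]
  exact HasCompactSupport.mul_left hg

lemma lip_ident (μ : CMeasure E) (T : SchwartzMap E ℂ →L[ℂ] ℂ) (hμT : μ.Agrees T)
    (φ : SchwartzMap E ℂ) (x v : E) :
    ∫ s in (0:ℝ)..1, convTD (fourierTD T) (∂_{v} φ) (x + s • v)
      = convTD (fourierTD T) φ (x + v) - convTD (fourierTD T) φ x := by
  have hfin : ∀ f : ℝ → ℝ, Continuous f → Integrable f (volume.restrict (Set.Ioc (0:ℝ) 1)) :=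
    fun f hf => (hf.integrableOn_Icc).mono_set Set.Ioc_subset_Icc_self
  have := key (volume.restrict (Set.Ioc (0:ℝ) 1)) (fun _ => (1:ℂ)) (fun s => x + s • v)
    (integrable_const _) (by fun_prop) (fun N => hfin _ (by fun_prop)) μ T hμT (Av v)
    (mE (x + v) - mE x) (fun g hg => Av_test v hg) (fun g hg => by
      exact HasCompactSupport.sub (mE_test _ hg) (mE_test _ hg)) (by
      intro g ξ
      have hd : ∀ s : ℝ, HasDerivAt (fun s : ℝ => ee (x + s • v) ξ)
          (-(2 * Real.pi * (inner ℝ v ξ : ℝ)) * I * ee (x + s • v) ξ) s := by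
        intro s
        have e : (fun s : ℝ => ee (x + s • v) ξ) = fun s : ℝ => Complex.exp
            (-(2 * Real.pi * ((inner ℝ x ξ : ℝ) + (s : ℂ) * (inner ℝ v ξ : ℝ))) * I) := by
          funext s
          rw [ee_exp, inner_add_left, real_inner_smul_left]; push_cast; rfl
        have e2 := congrFun e s
        beta_reduce at e2
        rw [e2, e]
        have h0 : HasDerivAt (fun s : ℝ => (s : ℂ)) 1 s := Complex.ofRealCLM.hasDerivAt
        have h1 := ((((h0.mul_const ((inner ℝ v ξ : ℝ) : ℂ)).const_add
          ((inner ℝ x ξ : ℝ) : ℂ)).const_mul (2 * Real.pi : ℂ)).fun_neg.mul_const I).cexp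
        convert h1 using 1
        ring
      have hc : Continuous fun s : ℝ => ee (x + s • v) ξ :=
        ee_cont.comp (by fun_prop : Continuous fun s : ℝ => (x + s • v, ξ))
      have hF := intervalIntegral.integral_eq_sub_of_hasDerivAt (fun s _ => hd s)
        (a := 0) (b := 1) (Continuous.intervalIntegrable (by fun_prop) _ _)
      rw [intervalIntegral.integral_const_mul, intervalIntegral.integral_of_le zero_le_one] at hF
      simp only [one_mul, Av_apply, sub_apply, one_smul, zero_smul, add_zero] at hF ⊢
      rw [mE_apply, mE_apply, ← sub_mul, ← hF]
      ring) (gph φ)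
  rw [intervalIntegral.integral_of_le zero_le_one]
  simp only [conv_eq, ← Av_gph]
  simpa using this

lemma lip (μ : CMeasure E) (T : SchwartzMap E ℂ →L[ℂ] ℂ) (hμT : μ.Agrees T)
    (hTB : TransBddD (fourierTD T)) {φ : SchwartzMap E ℂ} (hφ : IsTestFn φ) :
    ∃ C : ℝ, 0 ≤ C ∧ ∀ x v, ‖convTD (fourierTD T) φ (x + v) - convTD (fourierTD T) φ x‖ ≤ C * ‖v‖ := by
  let b := stdOrthonormalBasis ℝ E
  choose C hC using fun i => hTB _ (ld_test (b i) hφ)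
  have hC0 : ∀ i, 0 ≤ C i := fun i => (norm_nonneg _).trans (hC i 0)
  refine ⟨∑ i, C i, Finset.sum_nonneg fun i _ => hC0 i, fun x v => ?_⟩
  have hv : ∂_{v} φ = ∑ i, inner ℝ (b i) v • ∂_{b i} φ := by
    conv_lhs => rw [← b.sum_repr' v]
    rw [LineDeriv.lineDerivOp_left_sum]
    refine Finset.sum_congr rfl fun i _ => ?_
    rw [LineDeriv.lineDerivOp_left_smul]
  have hbd : ∀ z, ‖convTD (fourierTD T) (∂_{v} φ) z‖ ≤ (∑ i, C i) * ‖v‖ := by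
    intro z
    have : convTD (fourierTD T) (∂_{v} φ) z
        = ∑ i, ((inner ℝ (b i) v : ℝ) : ℂ) * convTD (fourierTD T) (∂_{b i} φ) z := by
      simp only [convTD, trC_eq, hv, map_sum]
      refine Finset.sum_congr rfl fun i _ => ?_
      rw [← smul_eq_mul, ← map_smul, ← map_smul]
      congr 2
    rw [this, Finset.sum_mul]
    refine (norm_sum_le _ _).trans (Finset.sum_le_sum fun i _ => ?_)
    rw [norm_mul, mul_comm]
    have h1 : ‖((inner ℝ (b i) v : ℝ) : ℂ)‖ ≤ ‖v‖ := by
      rw [Complex.norm_real]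
      refine (norm_inner_le_norm _ _).trans ?_
      simp
    exact mul_le_mul (hC i z) h1 (norm_nonneg _) (hC0 i)
  rw [← lip_ident μ T hμT φ x v]
  refine (intervalIntegral.norm_integral_le_of_norm_le_const (C := (∑ i, C i) * ‖v‖) fun s _ => hbd _).trans ?_
  simp

/-- The averaging kernel. -/
def KK (E : Type*) [NormedAddCommGroup E] [InnerProductSpace ℝ E] [FiniteDimensional ℝ E]
    [MeasurableSpace E] [BorelSpace E] : SchwartzMap E ℂ :=
  𝓕⁻ ((bmpC_compact (E := E)).toSchwartzMap bmpC_contDiff)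

lemma KK_ee (η : E) : ∫ y, KK E y * ee y η = bmpC η := by
  have h : 𝓕 (KK E) = (bmpC_compact (E := E)).toSchwartzMap bmpC_contDiff := by
    rw [KK, FourierTransform.fourier_fourierInv_eq]
  have h2 : (𝓕 (KK E)) η = bmpC η := by rw [h]; rfl
  rw [← h2, SchwartzMap.fourier_coe, Real.fourier_eq]
  congr 1
  funext v
  simp only [Circle.smul_def, smul_eq_mul, ee]
  ring

lemma KK_ee2 (x ξ : E) (n : ℕ) : ∫ y, KK E y * ee (x + scl n • y) ξ = ee x ξ * cutf n ξ := by
  rw [cutf, ← KK_ee, ← integral_const_mul]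
  congr 1
  funext y
  have : ee (scl n • y) ξ = ee y (scl n • ξ) := by
    simp [ee, real_inner_smul_left, real_inner_smul_right]
  rw [ee_add, this]; ring

lemma KK_int : ∫ y, KK E y = 1 := by
  have := KK_ee (0 : E)
  rw [bmpC_eq_one (by simp)] at this
  simpa [ee] using this

lemma KK_intg (N : ℕ) (x : E) (n : ℕ) :
    Integrable (fun y => (1 + ‖x + scl n • y‖) ^ N * ‖KK E y‖) := by
  have h1 : Integrable (fun y => (1 + ‖x‖) ^ N * (2 ^ (N - 1) * (‖KK E y‖ + ‖y‖ ^ N * ‖KK E y‖))) := by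
    refine (Integrable.const_mul ?_ _).const_mul _
    exact ((KK E).integrable.norm).add ((KK E).integrable_pow_mul volume N)
  refine h1.mono' ?_ (Eventually.of_forall fun y => ?_)
  · have := (KK E).continuous
    exact (by fun_prop : Continuous (fun y => (1 + ‖x + scl n • y‖) ^ N * ‖KK E y‖)).aestronglyMeasurable
  · rw [Real.norm_of_nonneg (by positivity)]
    have hs := scl_pos n
    have hs1 := scl_le n
    have a1 : ‖x + scl n • y‖ ≤ ‖x‖ + ‖y‖ := by
      refine (norm_add_le _ _).trans ?_
      rw [norm_smul, Real.norm_of_nonneg hs.le]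
      nlinarith [norm_nonneg y]
    have a2 : 1 + ‖x + scl n • y‖ ≤ (1 + ‖x‖) * (1 + ‖y‖) := by
      nlinarith [norm_nonneg y, norm_nonneg x]
    have a3 : (1 + ‖y‖) ^ N ≤ 2 ^ (N - 1) * (1 ^ N + ‖y‖ ^ N) :=
      add_pow_le zero_le_one (norm_nonneg y) N
    calc _ ≤ ((1 + ‖x‖) * (1 + ‖y‖)) ^ N * ‖KK E y‖ := by gcongr
      _ = (1 + ‖x‖) ^ N * ((1 + ‖y‖) ^ N * ‖KK E y‖) := by rw [mul_pow]; ring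
      _ ≤ (1 + ‖x‖) ^ N * ((2 ^ (N - 1) * (1 ^ N + ‖y‖ ^ N)) * ‖KK E y‖) := by gcongr
      _ = _ := by rw [one_pow]; ring

lemma approx_ident (μ : CMeasure E) (T : SchwartzMap E ℂ →L[ℂ] ℂ) (hμT : μ.Agrees T)
    (φ : SchwartzMap E ℂ) (x : E) (n : ℕ) :
    ∫ y, KK E y * convTD (fourierTD T) φ (x + scl n • y) = T (mE x (cutM n (gph φ))) := by
  have := key volume (KK E) (fun y => x + scl n • y) (KK E).integrable (by fun_prop)
    (fun N => KK_intg N x n) μ T hμT (ContinuousLinearMap.id ℂ _) (mE x ∘L cutM n)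
    (fun g hg => hg) (fun g hg => mE_test x (cutM_test n g)) (by
      intro g ξ
      rw [KK_ee2]
      simp only [ContinuousLinearMap.comp_apply, ContinuousLinearMap.id_apply, mE_apply, cutM_apply]
      ring) (gph φ)
  simp only [conv_eq]
  exact this

lemma approx (μ : CMeasure E) (T : SchwartzMap E ℂ →L[ℂ] ℂ) (hμT : μ.Agrees T)
    {φ : SchwartzMap E ℂ} {B C : ℝ} (hB : ∀ x, ‖convTD (fourierTD T) φ x‖ ≤ B)
    (hC : ∀ x v, ‖convTD (fourierTD T) φ (x + v) - convTD (fourierTD T) φ x‖ ≤ C * ‖v‖)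
    (x : E) (n : ℕ) :
    ‖T (mE x (cutM n (gph φ))) - convTD (fourierTD T) φ x‖
      ≤ scl n * (C * ∫ y, ‖y‖ * ‖KK E y‖) := by
  set f := convTD (fourierTD T) φ with hf
  have hcont : Continuous f := by
    refine continuous_iff_continuousAt.2 fun a => ?_
    rw [ContinuousAt, tendsto_iff_norm_sub_tendsto_zero]
    refine squeeze_zero (g := fun z => C * ‖z - a‖) (fun _ => norm_nonneg _) (fun z => ?_) ?_
    · simpa using hC a (z - a)
    · have : Continuous fun z => C * ‖z - a‖ := by fun_prop
      simpa using this.tendsto a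
  have h1 : ∫ y, KK E y * f x = f x := by rw [integral_mul_const, KK_int, one_mul]
  have i1 : Integrable fun y => KK E y * f (x + scl n • y) :=
    (KK E).integrable.mul_bdd (c := B) (by fun_prop : Continuous _).aestronglyMeasurable
      (Eventually.of_forall fun y => hB _)
  have i2 : Integrable fun y => KK E y * f x := (KK E).integrable.mul_const _
  have i3 : Integrable fun y => ‖y‖ * ‖KK E y‖ := by
    simpa using (KK E).integrable_pow_mul volume 1
  rw [← approx_ident μ T hμT φ x n]
  nth_rw 1 [← h1]
  rw [← integral_sub i1 i2, ← integral_const_mul, ← integral_const_mul]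
  refine norm_integral_le_of_norm_le ((i3.const_mul C).const_mul _) (Eventually.of_forall fun y => ?_)
  rw [← mul_sub, norm_mul]
  have := hC x (scl n • y)
  rw [norm_smul, Real.norm_of_nonneg (scl_pos n).le] at this
  calc _ ≤ ‖KK E y‖ * (C * (scl n * ‖y‖)) := by gcongr
    _ = _ := by ring

lemma tail (μ : CMeasure E) (hpp : μ.IsPurePoint) {G : E → ℂ} (hG : Integrable G μ.tv)
    {δ : ℝ} (hδ : 0 < δ) : ∃ F : Set E, F.Finite ∧ ∫ ξ in Fᶜ, ‖G ξ‖ ∂μ.tv < δ := by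
  obtain ⟨S, hS, h0⟩ := hpp
  obtain ⟨e, he⟩ := (hS.insert (0:E)).exists_eq_range (Set.insert_nonempty _ _)
  let A : ℕ → Set E := fun n => (e '' (Set.Iio n))ᶜ
  have hfin : ∀ n, (e '' (Set.Iio n)).Finite := fun n => (Set.finite_Iio n).image e
  have ht := tendsto_setIntegral_of_antitone (μ := μ.tv) (s := A) (f := fun ξ => ‖G ξ‖)
    (fun n => (hfin n).measurableSet.compl)
    (fun m n hmn => Set.compl_subset_compl.2 (Set.image_mono (Set.Iio_subset_Iio hmn)))
    ⟨0, hG.norm.integrableOn⟩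
  have hI : μ.tv (⋂ n, A n) = 0 := by
    refine measure_mono_null ?_ h0
    intro z hz hzS
    have : z ∈ Set.range e := he ▸ Set.mem_insert_of_mem _ hzS
    obtain ⟨k, rfl⟩ := this
    exact Set.mem_iInter.1 hz (k + 1) ⟨k, by simp, rfl⟩
  rw [setIntegral_measure_zero _ hI] at ht
  obtain ⟨n, hn⟩ := (ht.eventually_lt_const hδ).exists
  exact ⟨_, hfin n, hn⟩

lemma ee_zero (ξ : E) : ee 0 ξ = 1 := by simp [ee]

lemma reldense {F : Set E} (hF : F.Finite) {δ : ℝ} (hδ : 0 < δ) :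
    ∃ r : ℝ, ∀ x : E, ∃ a : E, (∀ ξ ∈ F, ‖ee (-a) ξ - 1‖ < δ) ∧ dist x a ≤ r := by
  have := hF.fintype
  let Φ : E → (F → ℂ) := fun t ξ => ee t ξ
  have htb : TotallyBounded (Set.range Φ) := by
    refine (isCompact_closedBall (0 : F → ℂ) 1).totallyBounded.subset ?_
    rintro _ ⟨t, rfl⟩
    rw [mem_closedBall_zero_iff, pi_norm_le_iff_of_nonneg zero_le_one]
    intro ξ
    exact (norm_ee _ _).le
  obtain ⟨P, hPs, hPf, hP⟩ := Metric.finite_approx_of_totallyBounded htb δ hδ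
  have hc : ∀ p : F → ℂ, ∃ t : E, p ∈ P → Φ t = p := by
    intro p
    by_cases hp : p ∈ P
    · obtain ⟨t, ht⟩ := hPs hp
      exact ⟨t, fun _ => ht⟩
    · exact ⟨0, fun h => absurd h hp⟩
  choose τ hτ using hc
  obtain ⟨r, hr⟩ := (hPf.image (fun p => ‖τ p‖)).bddAbove
  refine ⟨r, fun x => ?_⟩
  obtain ⟨p, hp, hxp⟩ := Set.mem_iUnion₂.1 (hP ⟨x, rfl⟩)
  refine ⟨x - τ p, fun ξ hξ => ?_, ?_⟩
  · have h1 : ‖ee x ξ - ee (τ p) ξ‖ < δ := by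
      rw [mem_ball, ← hτ p hp, dist_pi_lt_iff hδ] at hxp
      simpa [Φ, dist_eq_norm] using hxp ⟨ξ, hξ⟩
    have h2 : ee (τ p) ξ = ee x ξ * ee (-(x - τ p)) ξ := by
      rw [← ee_add]; congr 1; abel
    have h3 : ee x ξ - ee (τ p) ξ = -(ee x ξ * (ee (-(x - τ p)) ξ - 1)) := by rw [h2]; ring
    rw [h3, norm_neg, norm_mul, norm_ee, one_mul] at h1
    exact h1
  · rw [dist_eq_norm]
    simpa using hr ⟨p, hp, rfl⟩

lemma ap_test (μ : CMeasure E) (hpp : μ.IsPurePoint) (T : SchwartzMap E ℂ →L[ℂ] ℂ)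
    (hμT : μ.Agrees T) {g : SchwartzMap E ℂ} (hg : IsTestFn g) {ε : ℝ} (hε : 0 < ε) :
    IsRelativelyDense {t : E | ∀ x, ‖T (mE (x - t) g) - T (mE x g)‖ < ε} := by
  have hG := intg μ hg
  set G : E → ℂ := fun ξ => g ξ * μ.density ξ with hGd
  obtain ⟨F, hF, hFi⟩ := tail μ hpp hG (by positivity : 0 < ε / 4)
  set M := ∫ ξ, ‖G ξ‖ ∂μ.tv with hM
  have hM0 : 0 ≤ M := integral_nonneg fun _ => norm_nonneg _
  obtain ⟨r, hr⟩ := reldense hF (by positivity : 0 < ε / (4 * (M + 1)))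
  refine ⟨r, fun x => ?_⟩
  obtain ⟨a, ha, hd⟩ := hr x
  refine ⟨a, fun z => ?_, hd⟩
  have hmeas : ∀ z, AEStronglyMeasurable (fun ξ => ee z ξ) μ.tv := fun z =>
    (ee_cont.comp (by fun_prop : Continuous fun ξ => (z, ξ))).aestronglyMeasurable
  have hi : ∀ z, Integrable (fun ξ => ee z ξ * G ξ) μ.tv := fun z =>
    hG.bdd_mul (c := 1) (hmeas z) (Eventually.of_forall fun ξ => (norm_ee _ _).le)
  rw [T_mE μ T hμT hg, T_mE μ T hμT hg, ← integral_sub (hi _) (hi _)]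
  have hFm : MeasurableSet F := hF.measurableSet
  have hbi : Integrable (fun ξ => ε / (4 * (M + 1)) * ‖G ξ‖ + Fᶜ.indicator (fun ξ => 2 * ‖G ξ‖) ξ) μ.tv :=
    (hG.norm.const_mul _).add ((hG.norm.const_mul 2).indicator hFm.compl)
  have hle := norm_integral_le_of_norm_le (f := fun ξ => ee (z - a) ξ * G ξ - ee z ξ * G ξ) hbi
    (Eventually.of_forall fun ξ => by
      have e : ee (z - a) ξ * G ξ - ee z ξ * G ξ = ee z ξ * (ee (-a) ξ - 1) * G ξ := by
        rw [sub_eq_add_neg z a, ee_add]; ring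
      rw [e, norm_mul, norm_mul, norm_ee, one_mul]
      have hn := norm_nonneg (G ξ)
      by_cases hξ : ξ ∈ F
      · have : ξ ∉ Fᶜ := fun h => h hξ
        rw [Set.indicator_of_notMem this, add_zero]
        exact mul_le_mul_of_nonneg_right (ha ξ hξ).le hn
      · rw [Set.indicator_of_mem (show ξ ∈ Fᶜ from hξ)]
        have h2 : ‖ee (-a) ξ - 1‖ ≤ 2 := by
          refine (norm_sub_le _ _).trans ?_
          rw [norm_ee, norm_one]; norm_num
        have h3 : 0 ≤ ε / (4 * (M + 1)) * ‖G ξ‖ := by positivity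
        nlinarith)
  refine hle.trans_lt ?_
  rw [integral_add (hG.norm.const_mul _) ((hG.norm.const_mul 2).indicator hFm.compl),
    integral_indicator hFm.compl, integral_const_mul, integral_const_mul, ← hM]
  have h5 : ε / (4 * (M + 1)) * M ≤ ε / 4 := by
    rw [div_mul_eq_mul_div, div_le_div_iff₀ (by positivity) (by positivity)]
    nlinarith
  linarith

lemma main_lemma (μ : CMeasure E) (T : SchwartzMap E ℂ →L[ℂ] ℂ) (hμT : μ.Agrees T)
    (hTB : TransBddD (fourierTD T)) (hpp : μ.IsPurePoint) : SAPD (fourierTD T) := by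
  intro φ hφ
  obtain ⟨B, hB⟩ := hTB φ hφ
  obtain ⟨C, hC0, hC⟩ := lip μ T hμT hTB hφ
  refine ⟨?_, ⟨B, hB⟩, fun ε hε => ?_⟩
  · refine (LipschitzWith.of_dist_le_mul (K := ⟨C, hC0⟩) fun x y => ?_).uniformContinuous
    rw [dist_eq_norm, dist_eq_norm]
    have h := hC y (x - y)
    rw [add_sub_cancel] at h
    exact h
  · set D := C * ∫ y, ‖y‖ * ‖KK E y‖ with hD
    have hlim : Tendsto (fun n => scl n * D) atTop (𝓝 0) := by
      simpa using scl_tendsto.mul_const D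
    obtain ⟨n, hn⟩ := (hlim.eventually_lt_const (by positivity : 0 < ε / 4)).exists
    obtain ⟨r, hr⟩ := ap_test μ hpp T hμT (cutM_test n (gph φ)) (by positivity : 0 < ε / 2)
    refine ⟨r, fun x => ?_⟩
    obtain ⟨a, ha, hd⟩ := hr x
    refine ⟨a, fun z => ?_, hd⟩
    have h1 := approx μ T hμT hB hC z n
    have h2 := approx μ T hμT hB hC (z - a) n
    have h3 := ha z
    rw [← hD] at h1 h2
    set f := convTD (fourierTD T) φ
    have e : f (z - a) - f z = (T (mE (z - a) (cutM n (gph φ))) - T (mE z (cutM n (gph φ))))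
      - (T (mE (z - a) (cutM n (gph φ))) - f (z - a)) + (T (mE z (cutM n (gph φ))) - f z) := by ring
    rw [e]
    refine (norm_add_le _ _).trans_lt ?_
    have h4 := norm_sub_le (T (mE (z - a) (cutM n (gph φ))) - T (mE z (cutM n (gph φ))))
      (T (mE (z - a) (cutM n (gph φ))) - f (z - a))
    linarith

end Helpers

/-- If `T` is a tempered measure on `ℝ^d` whose Fourier transform is
translation bounded as a distribution and `T` is pure point, then `T̂` is strongly
almost periodic as a distribution. -/
theorem fourier_sapD_of_transBddD_of_purePoint (d : ℕ)
    (μ : CMeasure (EuclideanSpace ℝ (Fin d)))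
    (T : SchwartzMap (EuclideanSpace ℝ (Fin d)) ℂ →L[ℂ] ℂ)
    (hμT : μ.Agrees T)
    (hTB : TransBddD (fourierTD T))
    (hpp : μ.IsPurePoint) :
    SAPD (fourierTD T) := by
  exact main_lemma μ T hμT hTB hpp
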